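/- arXiv:2403.17762 — 2 statements merged into one kernel-verified Lean document; each statement's English description precedes it below -/
import Mathlib

section
/- Let d ≥ 1, let (M, Q) be a measurable space equipped with a probability measure Q, and let φ : ℝ^d × M × M → [0,1] be measurable with φ(x,p,q) = φ(−x,q,p) for all x,p,q and with ∫∫∫ φ(x,p,q) dx Q(dp) Q(dq) < ∞ (integration over ℝ^d with Lebesgue measure and over M² with Q⊗Q). Define recursively φ^{(1)} := φ and φ^{(n+1)}(x,p,q) := ∫_M ∫_{ℝ^d} φ^{(n)}(z,p,r) φ(x−z,r,q) dz Q(dr), and set d^{(n)}(p,q) := ∫_{ℝ^d} φ^{(n)}(x,p,q) dx. Then the following are equivalent: (a) for Q⊗Q-almost every (p,q) ∈ M² there exists n ≥ 1 with d^{(n)}(p,q) > 0; (b) for (Lebesgue ⊗ Q ⊗ Q)-almost every (x,p,q) ∈ ℝ^d × M² there exists n ≥ 1 with φ^{(n)}(x,p,q) > 0. -/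
open MeasureTheory
open scoped ENNReal

/-- Auxiliary iterated connection kernels: `phiIterAux Q φ k = φ^{(k+1)}`, where
`φ^{(n+1)}(x,p,q) = ∫_M ∫_{ℝ^d} φ^{(n)}(z,p,r) φ(x-z,r,q) dz Q(dr)`. -/
noncomputable def phiIterAux {d : ℕ} {M : Type*} [MeasurableSpace M] (Q : Measure M)
    (φ : EuclideanSpace ℝ (Fin d) → M → M → ℝ≥0∞) :
    ℕ → EuclideanSpace ℝ (Fin d) → M → M → ℝ≥0∞
  | 0 => φ
  | n + 1 => fun x p q => ∫⁻ r, (∫⁻ z, phiIterAux Q φ n z p r * φ (x - z) r q) ∂Q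

/-- `phiN Q φ n = φ^{(n)}` (meaningful for `n ≥ 1`): `φ^{(1)} = φ`. -/
noncomputable def phiN {d : ℕ} {M : Type*} [MeasurableSpace M] (Q : Measure M)
    (φ : EuclideanSpace ℝ (Fin d) → M → M → ℝ≥0∞) (n : ℕ) :
    EuclideanSpace ℝ (Fin d) → M → M → ℝ≥0∞ :=
  phiIterAux Q φ (n - 1)

/-- `dN Q φ n p q = d^{(n)}(p,q) = ∫_{ℝ^d} φ^{(n)}(x,p,q) dx`. -/
noncomputable def dN {d : ℕ} {M : Type*} [MeasurableSpace M] (Q : Measure M)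
    (φ : EuclideanSpace ℝ (Fin d) → M → M → ℝ≥0∞) (n : ℕ) (p q : M) : ℝ≥0∞ :=
  ∫⁻ x, phiN Q φ n x p q

namespace RandomConnection

section Kernel

variable {X : Type*} [MeasurableSpace X]

/-- Iterates of a kernel density `K` with respect to `μ`; `iterKernel μ K n` is the `(n+1)`-fold
composition of `K`. -/
noncomputable def iterKernel (μ : Measure X) (K : X → X → ℝ≥0∞) : ℕ → X → X → ℝ≥0∞
  | 0 => K
  | n + 1 => fun a b => ∫⁻ c, iterKernel μ K n a c * K c b ∂μ

/-- The points which are reached from `a` with positive density in finitely many steps. -/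
def reach (μ : Measure X) (K : X → X → ℝ≥0∞) (a : X) : Set X :=
  {b | ∃ n, 0 < iterKernel μ K n a b}

variable {μ : Measure X} [SFinite μ] {K : X → X → ℝ≥0∞}

lemma measurable_iterKernel (hK : Measurable fun t : X × X => K t.1 t.2) (n : ℕ) :
    Measurable fun t : X × X => iterKernel μ K n t.1 t.2 := by
  induction n with
  | zero => exact hK
  | succ n ih =>
    refine Measurable.lintegral_prod_right'
      (f := fun u : (X × X) × X => iterKernel μ K n u.1.1 u.2 * K u.2 u.1.2) ?_
    exact (ih.comp (measurable_fst.fst.prodMk measurable_snd)).mul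
      (hK.comp (measurable_snd.prodMk measurable_fst.snd))

lemma measurableSet_reach_prod (hK : Measurable fun t : X × X => K t.1 t.2) :
    MeasurableSet {t : X × X | t.2 ∈ reach μ K t.1} := by
  have : {t : X × X | t.2 ∈ reach μ K t.1} = ⋃ n, {t | 0 < iterKernel μ K n t.1 t.2} := by
    ext t; simp [reach]
  rw [this]
  exact .iUnion fun n => measurableSet_lt measurable_const (measurable_iterKernel hK n)

lemma iterKernel_succ' (hK : Measurable fun t : X × X => K t.1 t.2) (n : ℕ) (a b : X) :
    iterKernel μ K (n + 1) a b = ∫⁻ c, K a c * iterKernel μ K n c b ∂μ := by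
  induction n generalizing b with
  | zero => rfl
  | succ n ih =>
    have hI := measurable_iterKernel (μ := μ) hK n
    have hleft (c : X) : Measurable fun e => K a e * iterKernel μ K n e c :=
      (hK.comp (measurable_const.prodMk measurable_id)).mul
        (hI.comp (measurable_id.prodMk measurable_const))
    have hright (e : X) : Measurable fun c => iterKernel μ K n e c * K c b :=
      (hI.comp (measurable_const.prodMk measurable_id)).mul
        (hK.comp (measurable_id.prodMk measurable_const))
    calc iterKernel μ K (n + 1 + 1) a b
        = ∫⁻ c, (∫⁻ e, K a e * iterKernel μ K n e c ∂μ) * K c b ∂μ := by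
          simp only [← ih]; rfl
      _ = ∫⁻ c, ∫⁻ e, K a e * iterKernel μ K n e c * K c b ∂μ ∂μ :=
          lintegral_congr fun c => (lintegral_mul_const _ (hleft c)).symm
      _ = ∫⁻ e, ∫⁻ c, K a e * iterKernel μ K n e c * K c b ∂μ ∂μ := by
          refine lintegral_lintegral_swap (Measurable.aemeasurable ?_)
          exact ((hK.comp (measurable_const.prodMk measurable_snd)).mul
            (hI.comp measurable_swap)).mul
            (hK.comp (measurable_fst.prodMk measurable_const))
      _ = ∫⁻ e, K a e * iterKernel μ K (n + 1) e b ∂μ := by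
          refine lintegral_congr fun e => ?_
          simp only [mul_assoc]
          exact lintegral_const_mul _ (hright e)

lemma iterKernel_symm (hK : Measurable fun t : X × X => K t.1 t.2)
    (hsymm : ∀ a b, K a b = K b a) (n : ℕ) (a b : X) :
    iterKernel μ K n a b = iterKernel μ K n b a := by
  induction n generalizing a b with
  | zero => exact hsymm a b
  | succ n ih =>
    rw [iterKernel_succ' hK n b a]
    exact lintegral_congr fun c => by rw [ih a c, hsymm c b, mul_comm]

lemma ae_kernel_eq_zero_of_notMem_reach (hK : Measurable fun t : X × X => K t.1 t.2)
    {a b : X} (hb : b ∉ reach μ K a) : ∀ᵐ c ∂μ, c ∈ reach μ K a → K c b = 0 := by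
  have key : ∀ n, ∀ᵐ c ∂μ, iterKernel μ K n a c * K c b = 0 := by
    intro n
    have h : iterKernel μ K (n + 1) a b = 0 := by
      by_contra h
      exact hb ⟨n + 1, pos_iff_ne_zero.2 h⟩
    refine (lintegral_eq_zero_iff ?_).1 h
    exact ((measurable_iterKernel hK n).comp (measurable_const.prodMk measurable_id)).mul
      (hK.comp (measurable_id.prodMk measurable_const))
  filter_upwards [ae_all_iff.2 key] with c hc
  rintro ⟨n, hn⟩
  exact (mul_eq_zero.1 (hc n)).resolve_left hn.ne'

lemma ae_reach_subset (hK : Measurable fun t : X × X => K t.1 t.2) (a : X) :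
    ∀ᵐ c ∂μ, c ∈ reach μ K a → ∀ᵐ b ∂μ, b ∈ reach μ K c → b ∈ reach μ K a := by
  have hR : MeasurableSet (reach μ K a) :=
    measurable_prodMk_left (x := a) (measurableSet_reach_prod (μ := μ) hK)
  have hclosed : ∀ᵐ c ∂μ, ∀ᵐ b ∂μ, b ∉ reach μ K a → c ∈ reach μ K a → K c b = 0 := by
    refine (Measure.ae_ae_comm ?_).2 (ae_of_all _ fun b => ?_)
    · exact (hR.compl.preimage measurable_snd).imp <|
        (hR.preimage measurable_fst).imp (hK (measurableSet_singleton 0))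
    · by_cases hb : b ∈ reach μ K a
      · simp [hb]
      · simpa [hb] using ae_kernel_eq_zero_of_notMem_reach hK hb
  filter_upwards [hclosed] with c hc hca
  have key : ∀ n, ∀ᵐ b ∂μ, b ∉ reach μ K a → iterKernel μ K n c b = 0 := by
    intro n
    induction n with
    | zero => filter_upwards [hc] with b hb hba using hb hba hca
    | succ n ih =>
      refine ae_of_all _ fun b hb => ?_
      refine lintegral_eq_zero_of_ae_eq_zero ?_
      filter_upwards [ih, ae_kernel_eq_zero_of_notMem_reach hK hb] with e he he'
      by_cases hea : e ∈ reach μ K a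
      · simp [he' hea]
      · simp [he hea]
  filter_upwards [ae_all_iff.2 key] with b hb
  rintro ⟨n, hn⟩
  by_contra hba
  exact hn.ne' (hb n hba)

/-- The sets `reach μ K a` are, up to null sets, the classes of an equivalence relation. -/
lemma ae_reach_ae_eq (hK : Measurable fun t : X × X => K t.1 t.2)
    (hsymm : ∀ a b, K a b = K b a) :
    ∀ᵐ a ∂μ, ∀ᵐ c ∂μ, c ∈ reach μ K a → ∀ᵐ b ∂μ, b ∈ reach μ K a ↔ b ∈ reach μ K c := by
  have hR := measurableSet_reach_prod (μ := μ) hK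
  have hmem (a c : X) : a ∈ reach μ K c ↔ c ∈ reach μ K a := by
    simp only [reach, Set.mem_ofPred_eq, iterKernel_symm hK hsymm _ a c]
  have hrev : ∀ᵐ a ∂μ, ∀ᵐ c ∂μ,
      a ∈ reach μ K c → ∀ᵐ b ∂μ, b ∈ reach μ K a → b ∈ reach μ K c := by
    refine (Measure.ae_ae_comm ?_).2 (ae_of_all _ fun c => ae_reach_subset hK c)
    refine (hR.preimage measurable_swap).imp ?_
    have hS : MeasurableSet {u : (X × X) × X | ¬ (u.2 ∈ reach μ K u.1.1 → u.2 ∈ reach μ K u.1.2)} :=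
      ((hR.preimage (measurable_fst.fst.prodMk measurable_snd)).imp
        (hR.preimage (measurable_fst.snd.prodMk measurable_snd))).compl
    exact measurable_measure_prodMk_left (ν := μ) hS (measurableSet_singleton 0)
  filter_upwards [hrev] with a ha
  filter_upwards [ha, ae_reach_subset hK a] with c h1 h2 hc
  filter_upwards [h1 ((hmem a c).2 hc), h2 hc] with b hb1 hb2 using ⟨hb1, hb2⟩

end Kernel

section Translation

lemma addSubgroup_eq_top_of_mem_nhds {G : Type*} [AddGroup G] [TopologicalSpace G]
    [IsTopologicalAddGroup G] [PreconnectedSpace G] (H : AddSubgroup G)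
    (h : (H : Set G) ∈ nhds 0) : H = ⊤ := by
  have ho : IsOpen (H : Set G) := H.isOpen_of_mem_nhds h
  exact SetLike.coe_injective (IsClopen.eq_univ ⟨H.isClosed_of_isOpen ho, ho⟩ ⟨0, H.zero_mem⟩)

variable {E M : Type*} [NormedAddCommGroup E] [NormedSpace ℝ E] [FiniteDimensional ℝ E]
  [MeasurableSpace E] [BorelSpace E] [MeasurableSpace M]

/-- The translations under which `C` is invariant up to a null set. -/
def translationStabilizer (ν : Measure E) [ν.IsAddHaarMeasure] (Q : Measure M) [SFinite Q]
    (C : Set (E × M)) : AddSubgroup E where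
  carrier := {h | ∀ᵐ t ∂ν.prod Q, (t.1 + h, t.2) ∈ C ↔ t ∈ C}
  zero_mem' := by simp
  add_mem' {g h} hg hh := by
    have hp := (measurePreserving_add_right ν g).prod (MeasurePreserving.id Q)
    filter_upwards [hg, hp.quasiMeasurePreserving.ae hh] with t h1 h2
    rw [← h1, ← add_assoc]
    exact h2
  neg_mem' {h} hh := by
    have hp := (measurePreserving_add_right ν (-h)).prod (MeasurePreserving.id Q)
    filter_upwards [hp.quasiMeasurePreserving.ae hh] with t ht
    simpa [Prod.map] using ht.symm

variable {ν : Measure E} [ν.IsAddHaarMeasure] {Q : Measure M} [SFinite Q]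

lemma ae_slice_null_or_conull_of_stabilizer_eq_top {C : Set (E × M)} (hC : MeasurableSet C)
    (htop : translationStabilizer ν Q C = ⊤) :
    ∀ᵐ q ∂Q, (∀ᵐ y ∂ν, (y, q) ∉ C) ∨ ∀ᵐ y ∂ν, (y, q) ∈ C := by
  have hinv : ∀ᵐ h ∂ν, ∀ᵐ t ∂ν.prod Q, (t.1 + h, t.2) ∈ C ↔ t ∈ C :=
    ae_of_all _ fun h => by
      have : h ∈ translationStabilizer ν Q C := by rw [htop]; trivial
      exact this
  have hmeas : MeasurableSet {u : E × E × M | (u.2.1 + u.1, u.2.2) ∈ C ↔ u.2 ∈ C} :=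
    (hC.preimage ((measurable_snd.fst.add measurable_fst).prodMk measurable_snd.snd)).iff
      (hC.preimage measurable_snd)
  rw [Measure.ae_ae_comm hmeas] at hinv
  have hswap := Measure.ae_ae_of_ae_prod
    ((Measure.measurePreserving_swap (μ := Q) (ν := ν)).quasiMeasurePreserving.ae hinv)
  filter_upwards [hswap] with q hq
  by_cases hnull : ∀ᵐ y ∂ν, (y, q) ∉ C
  · exact .inl hnull
  · right
    rw [← Filter.not_frequently, not_not] at hnull
    obtain ⟨y, hy, hyq⟩ := (hnull.and_eventually hq).exists
    have hmem : ∀ᵐ h ∂ν, (y + h, q) ∈ C := by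
      filter_upwards [hyq] with h hh using hh.2 hy
    filter_upwards
      [(measurePreserving_add_left ν (-y)).quasiMeasurePreserving.ae hmem] with z hz
    simpa using hz

/-- If a set agrees almost everywhere with a translate, based at almost every one of its points, of
a set depending only on the mark of that point, then almost every slice is null or conull. -/
lemma ae_slice_null_or_conull {C : Set (E × M)} (hC : MeasurableSet C) (R : M → Set (E × M))
    (h : ∀ᵐ c ∂ν.prod Q, c ∈ C → ∀ᵐ t ∂ν.prod Q, t ∈ C ↔ (t.1 - c.1, t.2) ∈ R c.2) :
    ∀ᵐ q ∂Q, (∀ᵐ y ∂ν, (y, q) ∉ C) ∨ ∀ᵐ y ∂ν, (y, q) ∈ C := by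
  by_cases hnull : ∀ᵐ q ∂Q, ∀ᵐ y ∂ν, (y, q) ∉ C
  · filter_upwards [hnull] with q hq using .inl hq
  refine ae_slice_null_or_conull_of_stabilizer_eq_top hC (addSubgroup_eq_top_of_mem_nhds _ ?_)
  have hswap := Measure.ae_ae_of_ae_prod
    ((Measure.measurePreserving_swap (μ := Q) (ν := ν)).quasiMeasurePreserving.ae h)
  obtain ⟨q, hq, hgood⟩ := ((Filter.not_eventually.1 hnull).and_eventually hswap).exists
  set B : Set E := toMeasurable ν {y | ¬ ((y, q) ∈ C →
    ∀ᵐ t ∂ν.prod Q, t ∈ C ↔ (t.1 - y, t.2) ∈ R q)} with hB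
  have hB0 : ν B = 0 := by rw [hB, measure_toMeasurable]; exact hgood
  have hS : MeasurableSet {y | (y, q) ∈ C} := hC.preimage measurable_prodMk_right
  have hpos : 0 < ν ({y | (y, q) ∈ C} \ B) := by
    rw [measure_sdiff_null hB0, pos_iff_ne_zero]
    intro h0
    exact hq (measure_eq_zero_iff_ae_notMem.1 h0)
  refine Filter.mem_of_superset
    (Measure.sub_mem_nhds_zero_of_addHaar_pos ν _ (hS.diff (measurableSet_toMeasurable _ _)) hpos) ?_
  have hmem {y : E} (hy : y ∈ {y | (y, q) ∈ C} \ B) :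
      ∀ᵐ t ∂ν.prod Q, t ∈ C ↔ (t.1 - y, t.2) ∈ R q := by
    by_contra hcon
    exact hy.2 (subset_toMeasurable _ _ fun himp => hcon (himp hy.1))
  rintro _ ⟨y, hy, z, hz, rfl⟩
  have hp := (measurePreserving_add_right ν (y - z)).prod (MeasurePreserving.id Q)
  filter_upwards [hmem hz, hp.quasiMeasurePreserving.ae (hmem hy)] with t h1 h2
  rw [h1]
  refine h2.trans ?_
  have : t.1 + (y - z) - y = t.1 - z := by abel
  simp [this]

end Translation

section Marked

variable {d : ℕ} {M : Type*} [MeasurableSpace M] {Q : Measure M} [SFinite Q]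
  {φ : EuclideanSpace ℝ (Fin d) → M → M → ℝ≥0∞}

/-- The connection function of `φ` on the marked space. -/
def markedKernel (φ : EuclideanSpace ℝ (Fin d) → M → M → ℝ≥0∞)
    (a b : EuclideanSpace ℝ (Fin d) × M) : ℝ≥0∞ :=
  φ (b.1 - a.1) a.2 b.2

lemma measurable_markedKernel
    (hmeas : Measurable fun t : EuclideanSpace ℝ (Fin d) × M × M => φ t.1 t.2.1 t.2.2) :
    Measurable fun t : (EuclideanSpace ℝ (Fin d) × M) × (EuclideanSpace ℝ (Fin d) × M) =>
      markedKernel φ t.1 t.2 :=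
  hmeas.comp ((measurable_snd.fst.sub measurable_fst.fst).prodMk
    (measurable_fst.snd.prodMk measurable_snd.snd))

lemma iterKernel_markedKernel
    (hmeas : Measurable fun t : EuclideanSpace ℝ (Fin d) × M × M => φ t.1 t.2.1 t.2.2)
    (n : ℕ) (a b : EuclideanSpace ℝ (Fin d) × M) :
    iterKernel (volume.prod Q) (markedKernel φ) n a b =
      phiIterAux Q φ n (b.1 - a.1) a.2 b.2 := by
  have hK := measurable_markedKernel hmeas
  induction n generalizing b with
  | zero => rfl
  | succ n ih =>
    have hI := measurable_iterKernel (μ := volume.prod Q) hK n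
    have hm : Measurable fun c => iterKernel (volume.prod Q) (markedKernel φ) n a c *
        markedKernel φ c b :=
      (hI.comp (measurable_const.prodMk measurable_id)).mul
        (hK.comp (measurable_id.prodMk measurable_const))
    calc iterKernel (volume.prod Q) (markedKernel φ) (n + 1) a b
        = ∫⁻ r, ∫⁻ z, iterKernel (volume.prod Q) (markedKernel φ) n a (z, r) *
            markedKernel φ (z, r) b ∂volume ∂Q := lintegral_prod_symm' _ hm
      _ = phiIterAux Q φ (n + 1) (b.1 - a.1) a.2 b.2 := by
          refine lintegral_congr fun r => ?_
          simp only [ih, markedKernel]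
          rw [← lintegral_add_right_eq_self _ a.1]
          refine lintegral_congr fun z => ?_
          rw [add_sub_cancel_right, add_comm z, sub_add_eq_sub_sub]

lemma measurable_phiIterAux
    (hmeas : Measurable fun t : EuclideanSpace ℝ (Fin d) × M × M => φ t.1 t.2.1 t.2.2) (n : ℕ) :
    Measurable fun t : EuclideanSpace ℝ (Fin d) × M × M =>
      phiIterAux Q φ n t.1 t.2.1 t.2.2 := by
  have h := (measurable_iterKernel (μ := volume.prod Q) (measurable_markedKernel hmeas) n).comp
    (f := fun t : EuclideanSpace ℝ (Fin d) × M × M => ((0, t.2.1), (t.1, t.2.2)))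
    ((measurable_const.prodMk measurable_snd.fst).prodMk
      (measurable_fst.prodMk measurable_snd.snd))
  simpa [Function.comp_def, iterKernel_markedKernel hmeas] using h

/-- The increments in `ℝ^d` and marks which are reached from the mark `p`. -/
def reachFrom (Q : Measure M) (φ : EuclideanSpace ℝ (Fin d) → M → M → ℝ≥0∞) (p : M) :
    Set (EuclideanSpace ℝ (Fin d) × M) :=
  {t | ∃ n, 0 < phiIterAux Q φ n t.1 p t.2}

lemma measurableSet_reachFrom_prod
    (hmeas : Measurable fun t : EuclideanSpace ℝ (Fin d) × M × M => φ t.1 t.2.1 t.2.2) :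
    MeasurableSet {t : EuclideanSpace ℝ (Fin d) × M × M | (t.1, t.2.2) ∈ reachFrom Q φ t.2.1} := by
  have : {t : EuclideanSpace ℝ (Fin d) × M × M | (t.1, t.2.2) ∈ reachFrom Q φ t.2.1} =
      ⋃ n, {t | 0 < phiIterAux Q φ n t.1 t.2.1 t.2.2} := by
    ext t; simp [reachFrom]
  rw [this]
  exact .iUnion fun n => measurableSet_lt measurable_const (measurable_phiIterAux hmeas n)

lemma mem_reach_markedKernel
    (hmeas : Measurable fun t : EuclideanSpace ℝ (Fin d) × M × M => φ t.1 t.2.1 t.2.2)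
    (a b : EuclideanSpace ℝ (Fin d) × M) :
    b ∈ reach (volume.prod Q) (markedKernel φ) a ↔ (b.1 - a.1, b.2) ∈ reachFrom Q φ a.2 := by
  simp only [reach, reachFrom, Set.mem_ofPred_eq, iterKernel_markedKernel hmeas]

/-- For almost all pairs of marks, the set of increments reached is null or conull. -/
lemma ae_reachFrom_null_or_conull
    (hmeas : Measurable fun t : EuclideanSpace ℝ (Fin d) × M × M => φ t.1 t.2.1 t.2.2)
    (hsymm : ∀ x p q, φ x p q = φ (-x) q p) :
    ∀ᵐ p ∂Q, ∀ᵐ q ∂Q, (∀ᵐ y, (y, q) ∉ reachFrom Q φ p) ∨ ∀ᵐ y, (y, q) ∈ reachFrom Q φ p := by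
  have hK := measurable_markedKernel hmeas
  have hKsymm (a b : EuclideanSpace ℝ (Fin d) × M) : markedKernel φ a b = markedKernel φ b a := by
    rw [markedKernel, hsymm, neg_sub, markedKernel]
  have hswap := Measure.ae_ae_of_ae_prod ((Measure.measurePreserving_swap (μ := Q)
    (ν := (volume : Measure (EuclideanSpace ℝ (Fin d))))).quasiMeasurePreserving.ae
      (ae_reach_ae_eq (μ := volume.prod Q) hK hKsymm))
  filter_upwards [hswap] with p hp
  obtain ⟨x, hx⟩ := hp.exists
  have hC : MeasurableSet (reach (volume.prod Q) (markedKernel φ) (x, p)) :=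
    measurable_prodMk_left (x := (x, p)) (measurableSet_reach_prod (μ := volume.prod Q) hK)
  have hslice := ae_slice_null_or_conull (ν := volume) hC (reachFrom Q φ) <| by
    filter_upwards [hx] with c hc hcC
    filter_upwards [hc hcC] with t ht using ht.trans (mem_reach_markedKernel hmeas c t)
  have hshift := (measurePreserving_add_right
    (volume : Measure (EuclideanSpace ℝ (Fin d))) x).quasiMeasurePreserving
  filter_upwards [hslice] with q hq
  simp only [mem_reach_markedKernel hmeas] at hq
  refine hq.imp (fun h => ?_) (fun h => ?_)
  all_goals
    filter_upwards [hshift.ae h] with y hy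
    simpa using hy

lemma exists_phiN_pos_iff {Q : Measure M} {x : EuclideanSpace ℝ (Fin d)} {p q : M} :
    (∃ n : ℕ, 1 ≤ n ∧ 0 < phiN Q φ n x p q) ↔ (x, q) ∈ reachFrom Q φ p :=
  ⟨fun ⟨n, _, h⟩ => ⟨n - 1, h⟩, fun ⟨n, h⟩ => ⟨n + 1, by omega, h⟩⟩

lemma exists_dN_pos_iff
    (hmeas : Measurable fun t : EuclideanSpace ℝ (Fin d) × M × M => φ t.1 t.2.1 t.2.2) {p q : M} :
    (∃ n : ℕ, 1 ≤ n ∧ 0 < dN Q φ n p q) ↔ ¬ ∀ᵐ y, (y, q) ∉ reachFrom Q φ p := by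
  have hm (n : ℕ) : Measurable fun x => phiIterAux Q φ n x p q :=
    (measurable_phiIterAux hmeas n).comp (f := fun x => (x, p, q))
      (measurable_id.prodMk measurable_const)
  have hzero : (∀ᵐ y, (y, q) ∉ reachFrom Q φ p) ↔ ∀ n, ∫⁻ y, phiIterAux Q φ n y p q = 0 := by
    simp only [reachFrom, Set.mem_ofPred_eq, not_exists, not_lt, nonpos_iff_eq_zero]
    rw [ae_all_iff]
    exact forall_congr' fun n => (lintegral_eq_zero_iff (hm n)).symm
  rw [hzero, not_forall]
  constructor
  · rintro ⟨n, _, h⟩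
    exact ⟨n - 1, h.ne'⟩
  · rintro ⟨n, h⟩
    exact ⟨n + 1, by omega, pos_iff_ne_zero.2 h⟩

end Marked

end RandomConnection

/-- Characterization of irreducibility of the stationary marked RCM: positivity of some
mark kernel iterate `d^{(n)}(p,q)` for a.e. pair of marks is equivalent to positivity of
some iterated connection function `φ^{(n)}(x,p,q)` for a.e. `(x,p,q)`. -/
theorem irreducibility_characterization {d : ℕ} (hd : 1 ≤ d)
    {M : Type*} [MeasurableSpace M] (Q : Measure M) [IsProbabilityMeasure Q]
    (φ : EuclideanSpace ℝ (Fin d) → M → M → ℝ≥0∞)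
    (hmeas : Measurable fun t : EuclideanSpace ℝ (Fin d) × M × M => φ t.1 t.2.1 t.2.2)
    (hle : ∀ x p q, φ x p q ≤ 1)
    (hsymm : ∀ x p q, φ x p q = φ (-x) q p)
    (hint : (∫⁻ t : EuclideanSpace ℝ (Fin d) × M × M, φ t.1 t.2.1 t.2.2
        ∂((volume : Measure (EuclideanSpace ℝ (Fin d))).prod (Q.prod Q))) < ⊤) :
    (∀ᵐ pq ∂(Q.prod Q), ∃ n : ℕ, 1 ≤ n ∧ 0 < dN Q φ n pq.1 pq.2) ↔
      (∀ᵐ t ∂((volume : Measure (EuclideanSpace ℝ (Fin d))).prod (Q.prod Q)),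
        ∃ n : ℕ, 1 ≤ n ∧ 0 < phiN Q φ n t.1 t.2.1 t.2.2) := by
  open RandomConnection in
  simp only [exists_phiN_pos_iff, exists_dN_pos_iff hmeas]
  have hR := measurableSet_reachFrom_prod (Q := Q) hmeas
  have hprod : (∀ᵐ t ∂((volume : Measure (EuclideanSpace ℝ (Fin d))).prod (Q.prod Q)),
      (t.1, t.2.2) ∈ reachFrom Q φ t.2.1) ↔
      ∀ᵐ pq ∂(Q.prod Q), ∀ᵐ x, (x, pq.2) ∈ reachFrom Q φ pq.1 := by
    rw [Measure.ae_prod_iff_ae_ae hR]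
    exact Measure.ae_ae_comm hR
  rw [hprod]
  constructor
  · intro h
    have hmeasN : MeasurableSet {pq : M × M | (∀ᵐ y, (y, pq.2) ∉ reachFrom Q φ pq.1) ∨
        ∀ᵐ y, (y, pq.2) ∈ reachFrom Q φ pq.1} := by
      refine MeasurableSet.union ?_ ?_
      · exact measurable_measure_prodMk_right (μ := volume) hR.compl.compl
          (measurableSet_singleton 0)
      · exact measurable_measure_prodMk_right (μ := volume) hR.compl (measurableSet_singleton 0)
    filter_upwards [h, (Measure.ae_prod_iff_ae_ae hmeasN).2
      (ae_reachFrom_null_or_conull hmeas hsymm)] with pq h1 h2 using h2.resolve_left h1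
  · intro h
    filter_upwards [h] with pq h1 h2
    obtain ⟨y, hy, hy'⟩ := (h1.and h2).exists
    exact hy' hy
end

section
/- Let f : ℕ → ℝ satisfy f(n)·√(n · log n) → 0 as n → ∞. For each n ≥ 1 let ν_n be a Borel measure on [0,∞) with ν_1([0,u]) ≤ 1 for all u and ν_n([0,u]) ≤ (e·u/(n−1))^{n−1} for all u > 0 and n ≥ 2. For t > 0 set p_n(t) := t^n ∫_0^∞ ν_n([0,u]) e^{−t u} du, and assume ∑_{n≥1} p_n(t) ≤ 1 for every t > 0. Then the function t ↦ ∑_{n≥1} f(n) p_n(t) is continuously differentiable on (0,∞). -/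
open MeasureTheory Filter
open scoped ENNReal

/-- `clusterProb ν n t = t^n ∫_0^∞ ν_n([0,u]) e^{-tu} du`, the probability `p_n(t)` that the
cluster of a point has exactly `n` vertices at intensity `t`, written via the distribution
function of the cluster measure `ν_n`. -/
noncomputable def clusterProb (ν : ℕ → Measure ℝ) (n : ℕ) (t : ℝ) : ℝ≥0∞ :=
  ENNReal.ofReal (t ^ n) *
    ∫⁻ u in Set.Ioi (0 : ℝ), ν n (Set.Icc 0 u) * ENNReal.ofReal (Real.exp (-t * u))

/-- Locally uniform convergence of the termwise derivatives of `∑ f n * q n t`, where the weights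
`w n` control the logarithmic derivatives of the `q n` and `f n * w n → 0`. -/
theorem contDiffOn_one_tsum_of_weighted_deriv_bound {f w c : ℕ → ℝ} {q q' : ℕ → ℝ → ℝ}
    (hq : ∀ n, ∀ t ∈ Set.Ioi (0 : ℝ), HasDerivAt (q n) (q' n t) t)
    (hq'c : ∀ n, ContinuousOn (q' n) (Set.Ioi 0))
    (hq0 : ∀ n, ∀ t ∈ Set.Ioi (0 : ℝ), 0 ≤ q n t)
    (hqs : ∀ t ∈ Set.Ioi (0 : ℝ), Summable fun n => q n t)
    (hq1 : ∀ t ∈ Set.Ioi (0 : ℝ), ∑' n, q n t ≤ 1)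
    (hc0 : ∀ n, 0 ≤ c n) (hc : Summable c)
    (hb : ∀ᶠ n in atTop, ∀ t ∈ Set.Ioi (0 : ℝ), |q' n t| ≤ w n / t * (q n t + c n))
    (hw : ∀ᶠ n in atTop, 1 ≤ w n)
    (hfw : Tendsto (fun n => f n * w n) atTop (nhds 0)) :
    ContDiffOn ℝ 1 (fun t => ∑' n, f n * q n t) (Set.Ioi 0) := by
  have hsmall : ∀ ε > 0, ∀ᶠ n in atTop, |f n * w n| ≤ ε := fun ε hε => by
    filter_upwards [(Metric.tendsto_nhds.1 hfw) ε hε] with n hn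
    rw [Real.dist_eq, sub_zero] at hn
    exact hn.le
  have hterm : ∀ ε > 0, ∃ N₀, ∀ n ≥ N₀, ∀ t ∈ Set.Ioi (0 : ℝ),
      |f n * q' n t| ≤ ε / t * (q n t + c n) := fun ε hε => by
    rw [← eventually_atTop]
    filter_upwards [hb, hw, hsmall ε hε] with n hbn hwn hn t ht
    have ht' : 0 < t := ht
    have h0 : 0 ≤ q n t + c n := add_nonneg (hq0 n t ht) (hc0 n)
    calc |f n * q' n t| = |f n| * |q' n t| := abs_mul _ _
      _ ≤ |f n| * (w n / t * (q n t + c n)) := by gcongr; exact hbn t ht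
      _ = |f n * w n| / t * (q n t + c n) := by
          rw [abs_mul, abs_of_pos (show 0 < w n by linarith)]; ring
      _ ≤ ε / t * (q n t + c n) := by gcongr
  have hsumm : ∀ t ∈ Set.Ioi (0 : ℝ), Summable fun n => f n * q' n t := fun t ht => by
    obtain ⟨N₀, hN₀⟩ := hterm 1 one_pos
    refine Summable.of_norm_bounded_eventually_nat (((hqs t ht).add hc).mul_left (1 / t)) ?_
    filter_upwards [eventually_ge_atTop N₀] with n hn
    exact hN₀ n hn t ht
  have hsummf : ∀ t ∈ Set.Ioi (0 : ℝ), Summable fun n => f n * q n t := fun t ht => by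
    refine Summable.of_norm_bounded_eventually_nat (hqs t ht) ?_
    filter_upwards [hw, hsmall 1 one_pos] with n hwn hn
    have h0 := hq0 n t ht
    rw [abs_mul, abs_of_pos (show 0 < w n by linarith)] at hn
    have : |f n| ≤ 1 := (le_mul_of_one_le_right (abs_nonneg _) hwn).trans hn
    rw [Real.norm_eq_abs, abs_mul, abs_of_nonneg h0]
    exact mul_le_of_le_one_left h0 this
  have hS : 0 ≤ ∑' n, c n := tsum_nonneg hc0
  have htail : ∀ ε > 0, ∀ᶠ N in atTop, ∀ t ∈ Set.Ioi (0 : ℝ),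
      |∑' n, f n * q' n t - ∑ n ∈ Finset.range N, f n * q' n t|
        ≤ ε / t * (1 + ∑' n, c n) := fun ε hε => by
    obtain ⟨N₀, hN₀⟩ := hterm ε hε
    filter_upwards [eventually_ge_atTop N₀] with N hN t ht
    have ht' : 0 < t := ht
    rw [← (hsumm t ht).sum_add_tsum_nat_add N, add_sub_cancel_left]
    have hg : Summable fun n => ε / t * (q n t + c n) := ((hqs t ht).add hc).mul_left _
    calc |∑' n, f (n + N) * q' (n + N) t|
        ≤ ∑' n, ε / t * (q (n + N) t + c (n + N)) :=
          tsum_of_norm_bounded (f := fun n => f (n + N) * q' (n + N) t)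
            ((summable_nat_add_iff N).2 hg).hasSum fun n => hN₀ (n + N) (by omega) t ht
      _ ≤ ∑' n, ε / t * (q n t + c n) := by
          rw [← hg.sum_add_tsum_nat_add N]
          refine le_add_of_nonneg_left (Finset.sum_nonneg fun n _ => ?_)
          have := hq0 n t ht
          have := hc0 n
          positivity
      _ = ε / t * (∑' n, q n t + ∑' n, c n) := by
          rw [tsum_mul_left, (hqs t ht).tsum_add hc]
      _ ≤ ε / t * (1 + ∑' n, c n) := by gcongr; exact hq1 t ht
  have hloc : TendstoLocallyUniformlyOn
      (fun N t => ∑ n ∈ Finset.range N, f n * q' n t) (fun t => ∑' n, f n * q' n t)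
      atTop (Set.Ioi (0 : ℝ)) := by
    refine tendstoLocallyUniformlyOn_of_forall_exists_nhds fun a ha => ?_
    have ha' : 0 < a := ha
    refine ⟨Set.Ioi (a / 2), mem_nhdsWithin_of_mem_nhds (Ioi_mem_nhds (by linarith)), ?_⟩
    rw [Metric.tendstoUniformlyOn_iff]
    intro ε hε
    have hδ : 0 < ε / 2 * (a / 2) / (1 + ∑' n, c n) := by positivity
    filter_upwards [htail _ hδ] with N hN t ht
    have ht' : a / 2 < t := ht
    have ht0 : 0 < t := by linarith
    refine (hN t ht0).trans_lt ?_
    calc ε / 2 * (a / 2) / (1 + ∑' n, c n) / t * (1 + ∑' n, c n)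
        = ε / 2 * ((a / 2) / t) := by field_simp
      _ ≤ ε / 2 * 1 := by gcongr; exact (div_le_one ht0).2 ht'.le
      _ < ε := by linarith
  have hderiv : ∀ t ∈ Set.Ioi (0 : ℝ),
      HasDerivAt (fun t => ∑' n, f n * q n t) (∑' n, f n * q' n t) t := fun t ht =>
    hasDerivAt_of_tendstoLocallyUniformlyOn (f := fun N t => ∑ n ∈ Finset.range N, f n * q n t)
      isOpen_Ioi hloc
      (Eventually.of_forall fun N x hx =>
        HasDerivAt.fun_sum fun n _ => (hq n x hx).const_mul (f n))
      (fun x hx => (hsummf x hx).hasSum.tendsto_sum_nat) ht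
  have hcont : ContinuousOn (fun t => ∑' n, f n * q' n t) (Set.Ioi 0) :=
    hloc.continuousOn <| Frequently.of_forall fun N =>
      continuousOn_finsetSum _ fun n _ => continuousOn_const.mul (hq'c n)
  rw [contDiffOn_one_iff_derivWithin (uniqueDiffOn_Ioi 0)]
  refine ⟨fun t ht => (hderiv t ht).differentiableAt.differentiableWithinAt,
    hcont.congr fun t ht => ?_⟩
  rw [derivWithin_of_isOpen isOpen_Ioi ht, (hderiv t ht).deriv]

theorem one_le_one_sub_mul_exp {c : ℝ} (hc : |c| ≤ 1 / 2) :
    1 ≤ (1 - c) * Real.exp (c + c ^ 2) := by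
  obtain ⟨h1, h2⟩ := abs_le.1 hc
  have hpos : 0 ≤ 1 - c := by linarith
  rcases le_total 0 c with h | h
  · have := Real.quadratic_le_exp_of_nonneg (show 0 ≤ c + c ^ 2 by positivity)
    refine le_trans ?_ (mul_le_mul_of_nonneg_left this hpos)
    have : (1 - c) * (1 + (c + c ^ 2) + (c + c ^ 2) ^ 2 / 2) - 1
        = c ^ 2 / 2 * (1 - c - c ^ 2 - c ^ 3) := by ring
    have h3 : c ^ 2 ≤ 1 / 4 := by nlinarith
    have h4 : c ^ 3 ≤ 1 / 8 := by nlinarith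
    have : 0 ≤ c ^ 2 / 2 * (1 - c - c ^ 2 - c ^ 3) :=
      mul_nonneg (by positivity) (by linarith)
    linarith
  · have := Real.add_one_le_exp (c + c ^ 2)
    refine le_trans ?_ (mul_le_mul_of_nonneg_left this hpos)
    have : c ^ 2 * c ≤ 0 := mul_nonpos_of_nonneg_of_nonpos (sq_nonneg c) h
    nlinarith

theorem pow_mul_exp_neg_le_exp_tilt {m : ℕ} (hm : 0 < m) {s c : ℝ} (hs : 0 < s)
    (hc : |c| ≤ 1 / 2) :
    (Real.exp 1 * s / m) ^ m * Real.exp (-s) ≤ Real.exp (-c * (s - m) + m * c ^ 2) := by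
  have hm' : (0 : ℝ) < m := by exact_mod_cast hm
  obtain ⟨h1, h2⟩ := abs_le.1 hc
  have hpos : 0 < 1 - c := by linarith
  have hbase : Real.exp 1 * s / m ≤ Real.exp ((1 - c) * s / m + (c + c ^ 2)) := by
    have h3 := Real.add_one_le_exp ((1 - c) * s / m - 1)
    rw [sub_add_cancel] at h3
    calc Real.exp 1 * s / m ≤ Real.exp 1 * s / m * ((1 - c) * Real.exp (c + c ^ 2)) :=
          le_mul_of_one_le_right (by positivity) (one_le_one_sub_mul_exp hc)
      _ = Real.exp 1 * ((1 - c) * s / m) * Real.exp (c + c ^ 2) := by ring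
      _ ≤ Real.exp 1 * Real.exp ((1 - c) * s / m - 1) * Real.exp (c + c ^ 2) := by gcongr
      _ = Real.exp ((1 - c) * s / m + (c + c ^ 2)) := by
          rw [← Real.exp_add, ← Real.exp_add]; congr 1; ring
  calc (Real.exp 1 * s / m) ^ m * Real.exp (-s)
      ≤ Real.exp ((1 - c) * s / m + (c + c ^ 2)) ^ m * Real.exp (-s) := by gcongr
    _ = Real.exp (-c * (s - m) + m * c ^ 2) := by
        rw [← Real.exp_nat_mul, ← Real.exp_add]; congr 1; field_simp; ring

theorem pow_mul_exp_neg_le_exp_neg_abs {m : ℕ} (hm : 0 < m) {s l : ℝ} (hs : 0 < s)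
    (hl0 : 0 ≤ l) (hl : l ≤ 1 / 2) :
    (Real.exp 1 * s / m) ^ m * Real.exp (-s) ≤ Real.exp (-(l * |s - m|) + m * l ^ 2) := by
  have hl' : |l| ≤ 1 / 2 := by rwa [abs_of_nonneg hl0]
  rcases le_total 0 (s - m) with h | h
  · have := pow_mul_exp_neg_le_exp_tilt hm hs hl'
    rwa [abs_of_nonneg h, ← neg_mul]
  · have := pow_mul_exp_neg_le_exp_tilt hm hs (c := -l) (by rwa [abs_neg])
    rw [abs_of_nonpos h]
    refine this.trans_eq ?_
    congr 1
    ring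

theorem one_le_log_natCast {m : ℕ} (hm : 3 ≤ m) : 1 ≤ Real.log m := by
  have hm' : (3 : ℝ) ≤ m := by exact_mod_cast hm
  rw [Real.le_log_iff_exp_le (by linarith)]
  linarith [Real.exp_one_lt_d9]

/-- Outside the window `|s - m| ≤ 21 √(m log m)` the Poisson-type density `(es/m)^m e^{-s}` is
negligible. -/
theorem pow_mul_exp_neg_mul_abs_le {m : ℕ} (hm : 3 ≤ m) {s : ℝ} (hs : 0 < s)
    (hfar : 21 * Real.sqrt (m * Real.log m) < |s - m|) :
    (Real.exp 1 * s / m) ^ m * Real.exp (-s) * |m + 1 - s|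
      ≤ 1536 / (m : ℝ) ^ 2 * (1 + (s - m) ^ 2)⁻¹ := by
  have hm' : (3 : ℝ) ≤ m := by exact_mod_cast hm
  have hlog := one_le_log_natCast hm
  have hlogm : Real.log m ≤ m := (Real.log_le_sub_one_of_pos (by linarith)).trans (by linarith)
  set L := Real.sqrt (m * Real.log m) with hL
  have hLsq : L ^ 2 = m * Real.log m := Real.sq_sqrt (by positivity)
  have hL1 : 1 ≤ L := by rw [hL, Real.one_le_sqrt]; nlinarith
  have hLm : L ≤ m := by rw [hL, Real.sqrt_le_left (by linarith)]; nlinarith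
  set y := |s - m| with hy
  have hy1 : 1 ≤ y := by linarith
  set l := L / (2 * m) with hl
  have hl0 : 0 < l := by positivity
  have hl2 : l ≤ 1 / 2 := by rw [hl, div_le_iff₀ (by positivity)]; linarith
  have hml : m * l ^ 2 = Real.log m / 4 := by
    rw [hl, div_pow, hLsq]; field_simp; ring
  have hly : 21 * Real.log m / 2 ≤ l * y := by
    calc 21 * Real.log m / 2 = l * (21 * L) := by
          rw [hl, show L / (2 * m) * (21 * L) = 21 * L ^ 2 / (2 * m) by ring, hLsq]
          field_simp
      _ ≤ l * y := by gcongr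
  have habs : |m + 1 - s| ≤ 2 * y := by
    have : |m + 1 - s| ≤ |(1 : ℝ)| + |s - m| := by
      rw [show (m : ℝ) + 1 - s = 1 - (s - m) by ring]; exact abs_sub _ _
    rw [abs_one] at this
    linarith
  have hcube : y ^ 3 ≤ 384 * (m : ℝ) ^ 3 * Real.exp (l * y / 2) := by
    have h := Real.pow_div_factorial_le_exp (l * y / 2) (by positivity) 3
    have hlinv : 1 / (2 * m) ≤ l := by rw [hl]; gcongr
    have h6 : (y / (4 * m)) ^ 3 ≤ (l * y / 2) ^ 3 := by
      refine pow_le_pow_left₀ (by positivity) ?_ 3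
      calc y / (4 * m) = 1 / (2 * m) * y / 2 := by field_simp; ring
        _ ≤ l * y / 2 := by gcongr
    have h7 : (y / (4 * m)) ^ 3 ≤ 6 * Real.exp (l * y / 2) := by
      norm_num [Nat.factorial] at h
      linarith
    rw [div_pow, div_le_iff₀ (by positivity)] at h7
    linarith
  have hmexp : Real.exp (-(5 * Real.log m)) = ((m : ℝ) ^ 5)⁻¹ := by
    rw [Real.exp_neg, show (5 : ℝ) * Real.log m = ((5 : ℕ) : ℝ) * Real.log m by norm_num,
      Real.exp_nat_mul, Real.exp_log (by linarith)]
  rw [← div_eq_mul_inv, le_div_iff₀ (by positivity)]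
  have hsq : 1 + (s - m) ^ 2 ≤ 2 * y ^ 2 := by rw [hy, sq_abs, ← sq_abs, ← hy]; nlinarith
  calc (Real.exp 1 * s / m) ^ m * Real.exp (-s) * |m + 1 - s| * (1 + (s - m) ^ 2)
      ≤ Real.exp (-(l * y) + m * l ^ 2) * (2 * y) * (2 * y ^ 2) := by
        gcongr
        exact pow_mul_exp_neg_le_exp_neg_abs (by omega) hs hl0.le hl2
    _ = 4 * Real.exp (-(l * y) + m * l ^ 2) * y ^ 3 := by ring
    _ ≤ 4 * Real.exp (-(l * y) + m * l ^ 2) * (384 * (m : ℝ) ^ 3 * Real.exp (l * y / 2)) := by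
        gcongr
    _ = 1536 * (m : ℝ) ^ 3 * Real.exp (-(l * y / 2) + Real.log m / 4) := by
        rw [hml, show -(l * y / 2) + Real.log m / 4
          = (-(l * y) + Real.log m / 4) + l * y / 2 by ring, Real.exp_add _ (l * y / 2)]
        ring
    _ ≤ 1536 * (m : ℝ) ^ 3 * Real.exp (-(5 * Real.log m)) := by
        gcongr
        linarith
    _ = 1536 / (m : ℝ) ^ 2 := by rw [hmexp]; field_simp

theorem mul_exp_neg_mul_abs_le {m : ℕ} (hm : 3 ≤ m) {s φ : ℝ} (hs : 0 < s) (hφ0 : 0 ≤ φ)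
    (hφ : φ ≤ (Real.exp 1 * s / m) ^ m) :
    φ * Real.exp (-s) * |m + 1 - s|
      ≤ 22 * Real.sqrt ((m + 1) * Real.log (m + 1)) * (φ * Real.exp (-s))
        + 1536 / (m : ℝ) ^ 2 * (1 + (s - m) ^ 2)⁻¹ := by
  have hm' : (3 : ℝ) ≤ m := by exact_mod_cast hm
  have hlog := one_le_log_natCast hm
  by_cases hfar : 21 * Real.sqrt (m * Real.log m) < |s - m|
  · refine le_trans ?_ ((pow_mul_exp_neg_mul_abs_le hm hs hfar).trans
      (le_add_of_nonneg_left (by positivity)))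
    gcongr
  · have hL1 : 1 ≤ Real.sqrt (m * Real.log m) := by rw [Real.one_le_sqrt]; nlinarith
    have hmono : Real.sqrt (m * Real.log m) ≤ Real.sqrt ((m + 1) * Real.log (m + 1)) := by
      gcongr <;> linarith
    have habs : |m + 1 - s| ≤ |(1 : ℝ)| + |s - m| := by
      rw [show (m : ℝ) + 1 - s = 1 - (s - m) by ring]; exact abs_sub _ _
    rw [abs_one] at habs
    refine le_trans ?_ (le_add_of_nonneg_right (by positivity))
    rw [mul_comm]
    gcongr
    linarith

theorem measurable_measure_Icc_zero (μ : Measure ℝ) : Measurable fun u => μ (Set.Icc 0 u) :=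
  Monotone.measurable fun _ _ h => measure_mono (Set.Icc_subset_Icc_right h)

/-- The measure on `(0,∞)` whose Lebesgue density is the distribution function of `μ`; the
cluster size probabilities are moment generating functions of such measures. -/
noncomputable def distribMeasure (μ : Measure ℝ) : Measure ℝ :=
  (volume.restrict (Set.Ioi 0)).withDensity fun u => μ (Set.Icc 0 u)

theorem lintegral_exp_distribMeasure (μ : Measure ℝ) (t : ℝ) :
    ∫⁻ u, ENNReal.ofReal (Real.exp (t * u)) ∂distribMeasure μ
      = ∫⁻ u in Set.Ioi (0 : ℝ), μ (Set.Icc 0 u) * ENNReal.ofReal (Real.exp (t * u)) := by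
  rw [distribMeasure, lintegral_withDensity_eq_lintegral_mul _ (measurable_measure_Icc_zero μ)
    (by fun_prop)]
  rfl

theorem toReal_clusterProb (ν : ℕ → Measure ℝ) (n : ℕ) {t : ℝ} (ht : 0 < t) :
    (clusterProb ν n t).toReal = t ^ n * ProbabilityTheory.mgf id (distribMeasure (ν n)) (-t) := by
  rw [clusterProb, ENNReal.toReal_mul, ENNReal.toReal_ofReal (by positivity),
    ← lintegral_exp_distribMeasure, ProbabilityTheory.mgf,
    integral_eq_lintegral_of_nonneg_ae (ae_of_all _ fun u => (Real.exp_pos _).le) (by fun_prop)]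
  rfl

theorem integrable_exp_distribMeasure {ν : ℕ → Measure ℝ} {n : ℕ} {t : ℝ} (ht : 0 < t)
    (hfin : clusterProb ν n t ≠ ⊤) :
    Integrable (fun u => Real.exp (-t * u)) (distribMeasure (ν n)) := by
  refine ⟨by fun_prop, ?_⟩
  rw [hasFiniteIntegral_iff_ofReal (ae_of_all _ fun u => (Real.exp_pos _).le),
    lintegral_exp_distribMeasure, lt_top_iff_ne_top]
  intro htop
  refine hfin ?_
  rw [clusterProb, htop, ENNReal.mul_top]
  simpa using pow_pos ht n

theorem neg_mem_interior_integrableExpSet {ν : ℕ → Measure ℝ} {n : ℕ}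
    (hfin : ∀ t, 0 < t → clusterProb ν n t ≠ ⊤) {t : ℝ} (ht : 0 < t) :
    -t ∈ interior (ProbabilityTheory.integrableExpSet id (distribMeasure (ν n))) := by
  refine interior_maximal (t := Set.Iio 0) (fun x hx => ?_) isOpen_Iio (by simpa using ht)
  have hx' : 0 < -x := by simpa using hx
  simpa [ProbabilityTheory.integrableExpSet] using
    integrable_exp_distribMeasure hx' (hfin _ hx')

theorem hasDerivAt_toReal_clusterProb {ν : ℕ → Measure ℝ} {m : ℕ}
    (hfin : ∀ t, 0 < t → clusterProb ν (m + 1) t ≠ ⊤) {t : ℝ} (ht : 0 < t) :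
    HasDerivAt (fun t => (clusterProb ν (m + 1) t).toReal)
      (t ^ m * ∫ u, (m + 1 - t * u) * Real.exp (-t * u) ∂distribMeasure (ν (m + 1))) t := by
  have hint := neg_mem_interior_integrableExpSet hfin ht
  have hmgf := (ProbabilityTheory.hasDerivAt_mgf hint).scomp t (hasDerivAt_neg t)
  have hprod := (hasDerivAt_pow (m + 1) t).mul hmgf
  refine (hprod.congr_of_eventuallyEq ?_).congr_deriv ?_
  · filter_upwards [Ioi_mem_nhds ht] with x hx
    exact toReal_clusterProb ν (m + 1) hx
  · have h0 : Integrable (fun u => Real.exp (-t * u)) (distribMeasure (ν (m + 1))) :=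
      integrable_exp_distribMeasure ht (hfin t ht)
    have h1 : Integrable (fun u => u * Real.exp (-t * u)) (distribMeasure (ν (m + 1))) := by
      simpa using
        ProbabilityTheory.integrable_pow_mul_exp_of_mem_interior_integrableExpSet hint 1
    have hsplit : ∫ u, (m + 1 - t * u) * Real.exp (-t * u) ∂distribMeasure (ν (m + 1))
        = (m + 1) * ∫ u, Real.exp (-t * u) ∂distribMeasure (ν (m + 1))
          - t * ∫ u, u * Real.exp (-t * u) ∂distribMeasure (ν (m + 1)) := by
      rw [← integral_const_mul, ← integral_const_mul,
        ← integral_sub (h0.const_mul _) (h1.const_mul _)]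
      congr 1 with u
      ring
    rw [hsplit]
    simp only [Function.comp_apply, ProbabilityTheory.mgf, id, smul_eq_mul, Nat.cast_add,
      Nat.cast_one, Nat.add_sub_cancel]
    ring

theorem continuousOn_deriv_toReal_clusterProb {ν : ℕ → Measure ℝ} {n : ℕ}
    (hfin : ∀ t, 0 < t → clusterProb ν n t ≠ ⊤) :
    ContinuousOn (deriv fun t => (clusterProb ν n t).toReal) (Set.Ioi 0) := by
  have hanalytic : AnalyticOnNhd ℝ (fun t => (clusterProb ν n t).toReal) (Set.Ioi 0) := by
    refine AnalyticOnNhd.congr isOpen_Ioi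
      (f := fun t => t ^ n * ProbabilityTheory.mgf id (distribMeasure (ν n)) (-t))
      (fun t ht => ?_) fun t ht => (toReal_clusterProb ν n ht).symm
    exact (analyticAt_id.pow n).mul
      ((ProbabilityTheory.analyticAt_mgf (neg_mem_interior_integrableExpSet hfin ht)).comp
        analyticAt_id.neg)
  exact hanalytic.deriv.continuousOn

theorem integrable_inv_one_add_sq_mul_sub {t : ℝ} (ht : t ≠ 0) (a : ℝ) :
    Integrable fun u : ℝ => (1 + (t * u - a) ^ 2)⁻¹ :=
  (integrable_inv_one_add_sq.comp_sub_right a).comp_mul_left' ht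

theorem setIntegral_inv_one_add_sq_mul_sub_le {t : ℝ} (ht : 0 < t) (a : ℝ) :
    ∫ u in Set.Ioi (0 : ℝ), (1 + (t * u - a) ^ 2)⁻¹ ≤ Real.pi / t := by
  calc ∫ u in Set.Ioi (0 : ℝ), (1 + (t * u - a) ^ 2)⁻¹
      ≤ ∫ u : ℝ, (1 + (t * u - a) ^ 2)⁻¹ :=
        setIntegral_le_integral (integrable_inv_one_add_sq_mul_sub ht.ne' a)
          (ae_of_all _ fun u => by positivity)
    _ = Real.pi / t := by
        rw [Measure.integral_comp_mul_left fun s : ℝ => (1 + (s - a) ^ 2)⁻¹,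
          integral_sub_right_eq_self fun s : ℝ => (1 + s ^ 2)⁻¹, integral_univ_inv_one_add_sq,
          abs_of_pos (inv_pos.2 ht), smul_eq_mul, inv_mul_eq_div]

theorem abs_deriv_toReal_clusterProb_le {ν : ℕ → Measure ℝ} {m : ℕ} (hm : 3 ≤ m)
    (hbound : ∀ u : ℝ, 0 < u →
      ν (m + 1) (Set.Icc 0 u) ≤ ENNReal.ofReal ((Real.exp 1 * u / m) ^ m))
    (hfin : ∀ t, 0 < t → clusterProb ν (m + 1) t ≠ ⊤) {t : ℝ} (ht : 0 < t) :
    |deriv (fun t => (clusterProb ν (m + 1) t).toReal) t|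
      ≤ 22 * Real.sqrt ((m + 1) * Real.log (m + 1)) / t
        * ((clusterProb ν (m + 1) t).toReal + 1536 * Real.pi / (m : ℝ) ^ 2) := by
  have hm' : (3 : ℝ) ≤ m := by exact_mod_cast hm
  have hlog : 0 ≤ Real.log ((m : ℝ) + 1) := Real.log_nonneg (by linarith)
  set F : ℝ → ℝ := fun u => (ν (m + 1) (Set.Icc 0 u)).toReal
  set K : ℝ := 22 * Real.sqrt ((m + 1) * Real.log (m + 1)) with hK
  have hK1 : 1 ≤ K := by
    have h1 : (1 : ℝ) ≤ Real.sqrt ((m + 1) * Real.log (m + 1)) := by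
      have := one_le_log_natCast (m := m + 1) (by omega)
      push_cast at this
      rw [Real.one_le_sqrt]
      nlinarith
    linarith
  have hmeas := measurable_measure_Icc_zero (ν (m + 1))
  have hlt : ∀ᵐ u ∂volume.restrict (Set.Ioi (0 : ℝ)), ν (m + 1) (Set.Icc 0 u) < ⊤ :=
    (ae_restrict_iff' measurableSet_Ioi).2
      (ae_of_all _ fun u hu => (hbound u hu).trans_lt ENNReal.ofReal_lt_top)
  have hint := integrable_exp_distribMeasure ht (hfin t ht)
  have hintF : Integrable (fun u => F u * Real.exp (-t * u)) (volume.restrict (Set.Ioi 0)) :=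
    (integrable_withDensity_iff_integrable_smul' hmeas hlt).1 hint
  have hprob : (clusterProb ν (m + 1) t).toReal
      = t ^ (m + 1) * ∫ u in Set.Ioi (0 : ℝ), F u * Real.exp (-t * u) := by
    rw [toReal_clusterProb ν (m + 1) ht, ProbabilityTheory.mgf, distribMeasure,
      integral_withDensity_eq_integral_toReal_smul hmeas hlt]
    rfl
  have hcauchy := (integrable_inv_one_add_sq_mul_sub ht.ne' (m : ℝ)).integrableOn
    (s := Set.Ioi (0 : ℝ))
  have hpoint : ∀ u ∈ Set.Ioi (0 : ℝ),
      t ^ m * (F u * |(m + 1 - t * u) * Real.exp (-t * u)|)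
        ≤ K * t ^ m * (F u * Real.exp (-t * u))
          + 1536 / (m : ℝ) ^ 2 * (1 + (t * u - m) ^ 2)⁻¹ := fun u hu => by
    have hu' : 0 < u := hu
    have hFle : F u ≤ (Real.exp 1 * u / m) ^ m :=
      ENNReal.toReal_le_of_le_ofReal (by positivity) (hbound u hu)
    have hφ : t ^ m * F u ≤ (Real.exp 1 * (t * u) / m) ^ m := by
      calc t ^ m * F u ≤ t ^ m * (Real.exp 1 * u / m) ^ m := by gcongr
        _ = (Real.exp 1 * (t * u) / m) ^ m := by rw [← mul_pow]; congr 1; ring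
    have := mul_exp_neg_mul_abs_le hm (mul_pos ht hu')
      (mul_nonneg (pow_nonneg ht.le m) ENNReal.toReal_nonneg) hφ
    rw [← hK, ← neg_mul] at this
    rw [abs_mul, Real.abs_exp]
    calc _ = t ^ m * F u * Real.exp (-t * u) * |m + 1 - t * u| := by ring
      _ ≤ _ := this
      _ = _ := by ring
  rw [(hasDerivAt_toReal_clusterProb hfin ht).deriv, abs_mul, abs_of_nonneg (pow_nonneg ht.le m)]
  calc t ^ m * |∫ u, (m + 1 - t * u) * Real.exp (-t * u) ∂distribMeasure (ν (m + 1))|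
      ≤ t ^ m * ∫ u, |(m + 1 - t * u) * Real.exp (-t * u)| ∂distribMeasure (ν (m + 1)) := by
        gcongr
        exact abs_integral_le_integral_abs
    _ = ∫ u in Set.Ioi (0 : ℝ), t ^ m * (F u * |(m + 1 - t * u) * Real.exp (-t * u)|) := by
        rw [distribMeasure, integral_withDensity_eq_integral_toReal_smul hmeas hlt,
          integral_const_mul]
        rfl
    _ ≤ ∫ u in Set.Ioi (0 : ℝ), (K * t ^ m * (F u * Real.exp (-t * u))
          + 1536 / (m : ℝ) ^ 2 * (1 + (t * u - m) ^ 2)⁻¹) := by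
        refine integral_mono_of_nonneg
          (ae_of_all _ fun u => mul_nonneg (pow_nonneg ht.le m)
            (mul_nonneg ENNReal.toReal_nonneg (abs_nonneg _)))
          ((hintF.const_mul _).add (hcauchy.const_mul _)) ?_
        exact (ae_restrict_iff' measurableSet_Ioi).2 (ae_of_all _ hpoint)
    _ = K * t ^ m * (∫ u in Set.Ioi (0 : ℝ), F u * Real.exp (-t * u))
          + 1536 / (m : ℝ) ^ 2 * ∫ u in Set.Ioi (0 : ℝ), (1 + (t * u - m) ^ 2)⁻¹ := by
        rw [integral_add (hintF.const_mul _) (hcauchy.const_mul _), integral_const_mul,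
          integral_const_mul]
    _ ≤ K * t ^ m * (∫ u in Set.Ioi (0 : ℝ), F u * Real.exp (-t * u))
          + K * (1536 / (m : ℝ) ^ 2 * (Real.pi / t)) := by
        refine add_le_add le_rfl (le_trans ?_ <| le_mul_of_one_le_left (by positivity) hK1)
        gcongr
        exact setIntegral_inv_one_add_sq_mul_sub_le ht m
    _ = K / t * ((clusterProb ν (m + 1) t).toReal + 1536 * Real.pi / (m : ℝ) ^ 2) := by
        rw [hprob]
        field_simp
        ring

/-- Continuous differentiability of cluster expectations: if `f(n)√(n log n) → 0`, the
measures `ν_n` satisfy the distribution-function bounds of Lemma 9.2, and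
`∑_{n≥1} p_n(t) ≤ 1` for all `t > 0`, then `t ↦ ∑_{n≥1} f(n) p_n(t)` is continuously
differentiable on `(0,∞)`. -/
theorem clusterExpectation_contDiff (f : ℕ → ℝ)
    (hf : Tendsto (fun n : ℕ => f n * Real.sqrt (n * Real.log n)) atTop (nhds 0))
    (ν : ℕ → Measure ℝ) (hNeg : ∀ n, ν n (Set.Iio 0) = 0)
    (h1 : ∀ u : ℝ, ν 1 (Set.Icc 0 u) ≤ 1)
    (hbound : ∀ n : ℕ, 2 ≤ n → ∀ u : ℝ, 0 < u →
      ν n (Set.Icc 0 u) ≤ ENNReal.ofReal ((Real.exp 1 * u / ((n : ℝ) - 1)) ^ (n - 1)))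
    (hsum : ∀ t : ℝ, 0 < t → (∑' n : ℕ, clusterProb ν (n + 1) t) ≤ 1) :
    ContDiffOn ℝ 1 (fun t : ℝ => ∑' n : ℕ, f (n + 1) * (clusterProb ν (n + 1) t).toReal)
      (Set.Ioi (0 : ℝ)) := by
  have hfin : ∀ n : ℕ, ∀ t, 0 < t → clusterProb ν (n + 1) t ≠ ⊤ := fun n t ht =>
    ne_top_of_le_ne_top ENNReal.one_ne_top ((ENNReal.le_tsum n).trans (hsum t ht))
  have htop : ∀ t, 0 < t → ∑' n : ℕ, clusterProb ν (n + 1) t ≠ ⊤ := fun t ht =>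
    ne_top_of_le_ne_top ENNReal.one_ne_top (hsum t ht)
  refine contDiffOn_one_tsum_of_weighted_deriv_bound (f := fun n => f (n + 1))
    (w := fun n => 22 * Real.sqrt ((n + 1) * Real.log (n + 1)))
    (c := fun n => 1536 * Real.pi / (n : ℝ) ^ 2)
    (q := fun n t => (clusterProb ν (n + 1) t).toReal)
    (q' := fun n => deriv fun t => (clusterProb ν (n + 1) t).toReal)
    (fun n t ht => (hasDerivAt_toReal_clusterProb (hfin n) ht).differentiableAt.hasDerivAt)
    (fun n => continuousOn_deriv_toReal_clusterProb (hfin n))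
    (fun _ _ _ => ENNReal.toReal_nonneg)
    (fun t ht => ENNReal.summable_toReal (htop t ht)) (fun t ht => ?_)
    (fun n => by positivity) ?_ ?_ ?_ ?_
  · rw [← ENNReal.tsum_toReal_eq fun n => hfin n t ht]
    exact ENNReal.toReal_le_of_le_ofReal zero_le_one (by simpa using hsum t ht)
  · simpa only [div_eq_mul_inv] using
      (Real.summable_nat_pow_inv.2 one_lt_two).mul_left (1536 * Real.pi)
  · filter_upwards [eventually_ge_atTop 3] with n hn t ht
    refine abs_deriv_toReal_clusterProb_le hn (fun u hu => ?_) (hfin n) ht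
    simpa using hbound (n + 1) (by omega) u hu
  · filter_upwards [eventually_ge_atTop 3] with n hn
    have hlog := one_le_log_natCast (m := n + 1) (by omega)
    push_cast at hlog
    have : (1 : ℝ) ≤ Real.sqrt ((n + 1) * Real.log (n + 1)) := by
      rw [Real.one_le_sqrt]
      nlinarith [Nat.cast_nonneg (α := ℝ) n]
    linarith
  · have := ((tendsto_add_atTop_iff_nat 1).2 hf).const_mul 22
    rw [mul_zero] at this
    refine this.congr fun n => ?_
    push_cast
    ring
end
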